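/- Let α ≥ 0 be a real number and let β ≥ 1, n ≥ 2β be integers. Suppose G maximizes the α-spectral radius ρ_α among all simple graphs on n vertices with matching number β, and that the Tutte–Berge minimum min_{S ⊆ V(G)} ( n − o(G−S) + |S| ) is attained at a set S of size s ≥ 1; set q = n + s − 2β. Then there exist positive integers n₁, …, n_q with n₁ + ⋯ + n_q = n − s such that G is isomorphic to the join K_s ∨ (K_{n₁} ∪ K_{n₂} ∪ ⋯ ∪ K_{n_q}). -/

import Mathlib

open scoped Classical

/-- The adjacency matrix of a graph, over ℝ. -/
noncomputable def adjMat {V : Type*} [Fintype V] (G : SimpleGraph V) : Matrix V V ℝ :=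
  fun i j => if G.Adj i j then 1 else 0

/-- The diagonal matrix of vertex degrees, over ℝ. -/
noncomputable def degMat {V : Type*} [Fintype V] (G : SimpleGraph V) : Matrix V V ℝ :=
  fun i j => if i = j then ((G.neighborSet i).ncard : ℝ) else 0

/-- The largest (real) eigenvalue of a matrix. -/
noncomputable def specRad {V : Type*} [Fintype V] (M : Matrix V V ℝ) : ℝ :=
  sSup {t : ℝ | ∃ v : V → ℝ, v ≠ 0 ∧ M.mulVec v = t • v}

/-- The α-spectral radius: the largest eigenvalue of A_α(G) = α·D(G) + A(G). -/
noncomputable def alphaRadius {V : Type*} [Fintype V] (α : ℝ) (G : SimpleGraph V) : ℝ :=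
  specRad (α • degMat G + adjMat G)

/-- The matching number of a graph. -/
noncomputable def matchingNumber {V : Type*} [Fintype V] (G : SimpleGraph V) : ℕ :=
  sSup {m : ℕ | ∃ M : G.Subgraph, M.IsMatching ∧ M.edgeSet.ncard = m}

/-- The join of two graphs. -/
def graphJoin {A B : Type*} (G : SimpleGraph A) (H : SimpleGraph B) : SimpleGraph (A ⊕ B) :=
  SimpleGraph.fromRel (fun x y => match x, y with
    | Sum.inl a, Sum.inl b => G.Adj a b
    | Sum.inr a, Sum.inr b => H.Adj a b
    | _, _ => True)

/-- The disjoint union of two graphs. -/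
def graphSum {A B : Type*} (G : SimpleGraph A) (H : SimpleGraph B) : SimpleGraph (A ⊕ B) :=
  SimpleGraph.fromRel (fun x y => match x, y with
    | Sum.inl a, Sum.inl b => G.Adj a b
    | Sum.inr a, Sum.inr b => H.Adj a b
    | _, _ => False)

/-- The number of odd components of G − S. -/
noncomputable def oddComponentsOutside {V : Type*} [Fintype V] (G : SimpleGraph V) (S : Set V) : ℕ :=
  Set.ncard {c : (G.induce Sᶜ).ConnectedComponent | Odd c.supp.ncard}

/-- The disjoint union of cliques K_{f 0} ∪ ⋯ ∪ K_{f (q-1)}. -/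
def cliquesUnion (q : ℕ) (f : Fin q → ℕ) : SimpleGraph (Σ i : Fin q, Fin (f i)) :=
  SimpleGraph.fromRel (fun x y => x.1 = y.1)

open Matrix in
lemma finite_setOf_eigenvalue {V : Type*} [Fintype V] (M : Matrix V V ℝ) :
    {t : ℝ | ∃ v : V → ℝ, v ≠ 0 ∧ M *ᵥ v = t • v}.Finite := by
  refine (Module.End.finite_hasEigenvalue (Matrix.toLin' M)).subset ?_
  rintro t ⟨v, hv, h⟩
  exact Module.End.hasEigenvalue_of_hasEigenvector
    (Module.End.hasEigenvector_iff.2 ⟨Module.End.mem_eigenspace_iff.2 (by simpa using h), hv⟩)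

open Matrix in
lemma exists_mulVec_eq_specRad_smul {V : Type*} [Fintype V] [Nonempty V] {M : Matrix V V ℝ}
    (hM : M.IsHermitian) : ∃ v : V → ℝ, v ≠ 0 ∧ M *ᵥ v = specRad M • v := by
  refine Set.Nonempty.csSup_mem (s := {t : ℝ | ∃ v : V → ℝ, v ≠ 0 ∧ M *ᵥ v = t • v}) ?_
    (finite_setOf_eigenvalue M)
  obtain ⟨i⟩ := ‹Nonempty V›
  refine ⟨hM.eigenvalues i, (hM.eigenvectorBasis i).ofLp, fun h => ?_, hM.mulVec_eigenvectorBasis i⟩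
  exact hM.eigenvectorBasis.orthonormal.ne_zero i (by ext j; exact congrFun h j)

open Matrix in
lemma posSemidef_specRad_smul_one_sub {V : Type*} [Fintype V] {M : Matrix V V ℝ}
    (hM : M.IsHermitian) : (specRad M • (1 : Matrix V V ℝ) - M).PosSemidef := by
  have hB : (specRad M • (1 : Matrix V V ℝ) - M).IsHermitian :=
    (Matrix.isHermitian_one.smul (IsSelfAdjoint.all _)).sub hM
  rw [hB.posSemidef_iff_eigenvalues_nonneg]
  intro i
  have h1 := hB.mulVec_eigenvectorBasis i
  have h2 : specRad M - hB.eigenvalues i ≤ specRad M := by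
    refine le_csSup (finite_setOf_eigenvalue M).bddAbove
      ⟨(hB.eigenvectorBasis i).ofLp, fun h => ?_, ?_⟩
    · exact hB.eigenvectorBasis.orthonormal.ne_zero i (by ext j; exact congrFun h j)
    · rw [sub_mulVec, smul_mulVec, one_mulVec] at h1
      rw [sub_smul, ← h1, sub_sub_cancel]
  simpa using h2

open Matrix in
lemma pos_of_mulVec_eq_smul_of_connected {V : Type*} [Fintype V] {M : Matrix V V ℝ}
    {H : SimpleGraph V} (hH : H.Connected) (hM : ∀ i j, 0 ≤ M i j)
    (hMH : ∀ i j, H.Adj i j → 0 < M i j) {w : V → ℝ} (hw : ∀ i, 0 ≤ w i) (hw0 : w ≠ 0) {t : ℝ}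
    (h : M *ᵥ w = t • w) (i : V) : 0 < w i := by
  refine (hw i).lt_of_ne' fun hi => hw0 ?_
  have step : ∀ a b, H.Adj a b → w a = 0 → w b = 0 := by
    intro a b hab ha
    have h1 : ∑ j, M a j * w j = 0 := by
      have := congrFun h a
      simpa [mulVec, dotProduct, ha] using this
    have h2 := (Finset.sum_eq_zero_iff_of_nonneg
      (fun j _ => mul_nonneg (hM a j) (hw j))).1 h1 b (Finset.mem_univ b)
    exact (mul_eq_zero.1 h2).resolve_left (hMH a b hab).ne'
  funext j
  obtain ⟨p⟩ := hH.preconnected i j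
  induction p with
  | nil => exact hi
  | cons hab _ ih => exact ih (step _ _ hab hi)

open Matrix in
lemma specRad_lt_specRad_of_connected {V : Type*} [Fintype V] {A B : Matrix V V ℝ}
    (hA : A.IsHermitian) (hB : B.IsHermitian) (hA0 : ∀ i j, 0 ≤ A i j)
    (hAB : ∀ i j, A i j ≤ B i j) {H : SimpleGraph V} (hH : H.Connected)
    (hBH : ∀ i j, H.Adj i j → 0 < B i j) {a b : V} (hab : A a b < B a b) :
    specRad A < specRad B := by
  have : Nonempty V := ⟨a⟩
  by_contra! hle
  obtain ⟨v, hv0, hv⟩ := exists_mulVec_eq_specRad_smul hA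
  set w : V → ℝ := fun i => |v i| with hw
  have hwn : ∀ i, 0 ≤ w i := fun i => abs_nonneg _
  have hw0 : w ≠ 0 := fun h => hv0 (by
    funext i; simpa [hw] using congrFun h i)
  have hww : w ⬝ᵥ w = v ⬝ᵥ v := by
    simp [dotProduct, hw]
  have quad : ∀ (M : Matrix V V ℝ) (x : V → ℝ), x ⬝ᵥ M *ᵥ x = ∑ i, ∑ j, x i * (M i j * x j) := by
    intro M x
    simp [dotProduct, mulVec, Finset.mul_sum]
  have hAv : v ⬝ᵥ A *ᵥ v ≤ w ⬝ᵥ A *ᵥ w := by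
    rw [quad, quad]
    refine Finset.sum_le_sum fun i _ => Finset.sum_le_sum fun j _ => (le_abs_self _).trans ?_
    rw [abs_mul, abs_mul, abs_of_nonneg (hA0 i j)]
  have hle' : ∀ i j, w i * (A i j * w j) ≤ w i * (B i j * w j) := fun i j =>
    mul_le_mul_of_nonneg_left (mul_le_mul_of_nonneg_right (hAB i j) (hwn j)) (hwn i)
  have hABw : w ⬝ᵥ A *ᵥ w ≤ w ⬝ᵥ B *ᵥ w := by
    rw [quad, quad]
    exact Finset.sum_le_sum fun i _ => Finset.sum_le_sum fun j _ => hle' i j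
  have hpsd := posSemidef_specRad_smul_one_sub hB
  have hform : star w ⬝ᵥ (specRad B • (1 : Matrix V V ℝ) - B) *ᵥ w
      = specRad B * (w ⬝ᵥ w) - w ⬝ᵥ B *ᵥ w := by
    rw [sub_mulVec, smul_mulVec, one_mulVec, dotProduct_sub, dotProduct_smul]
    simp
  have hBw : w ⬝ᵥ B *ᵥ w ≤ specRad B * (w ⬝ᵥ w) := by
    have := hpsd.dotProduct_mulVec_nonneg w
    rw [hform] at this
    linarith
  have hAv' : v ⬝ᵥ A *ᵥ v = specRad A * (w ⬝ᵥ w) := by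
    rw [hv, dotProduct_smul, hww, smul_eq_mul]
  have hwwn : 0 ≤ w ⬝ᵥ w := Finset.sum_nonneg fun i _ => mul_nonneg (hwn i) (hwn i)
  have hρ : specRad B * (w ⬝ᵥ w) ≤ specRad A * (w ⬝ᵥ w) :=
    mul_le_mul_of_nonneg_right hle hwwn
  have hBeig : B *ᵥ w = specRad B • w := by
    have h0 : star w ⬝ᵥ (specRad B • (1 : Matrix V V ℝ) - B) *ᵥ w = 0 := by
      rw [hform]; linarith
    have h1 := (hpsd.dotProduct_mulVec_zero_iff w).1 h0
    rw [sub_mulVec, smul_mulVec, one_mulVec] at h1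
    exact (sub_eq_zero.1 h1).symm
  have hpos := pos_of_mulVec_eq_smul_of_connected hH
    (fun i j => (hA0 i j).trans (hAB i j)) hBH hwn hw0 hBeig
  have hlt : w ⬝ᵥ A *ᵥ w < w ⬝ᵥ B *ᵥ w := by
    rw [quad, quad]
    refine Finset.sum_lt_sum (fun i _ => Finset.sum_le_sum fun j _ => hle' i j)
      ⟨a, Finset.mem_univ a, Finset.sum_lt_sum (fun j _ => hle' a j) ⟨b, Finset.mem_univ b, ?_⟩⟩
    exact mul_lt_mul_of_pos_left (mul_lt_mul_of_pos_right hab (hpos b)) (hpos a)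
  linarith

lemma alphaRadius_lt_of_lt_of_connected {V : Type*} [Fintype V] {α : ℝ} (hα : 0 ≤ α)
    {G H : SimpleGraph V} (hGH : G < H) (hH : H.Connected) :
    alphaRadius α G < alphaRadius α H := by
  have herm : ∀ K : SimpleGraph V, (α • degMat K + adjMat K).IsHermitian := by
    intro K
    ext i j
    simp only [Matrix.conjTranspose_apply, Matrix.add_apply, Matrix.smul_apply, degMat, adjMat,
      K.adj_comm j i, star_trivial]
    by_cases h : i = j
    · subst h; rfl
    · simp [h, Ne.symm h]
  have deg0 : ∀ (K : SimpleGraph V) i j, 0 ≤ α * degMat K i j := fun K i j =>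
    mul_nonneg hα (by unfold degMat; split_ifs <;> positivity)
  have adj0 : ∀ (K : SimpleGraph V) i j, 0 ≤ adjMat K i j := fun K i j => by
    unfold adjMat; split_ifs <;> simp
  have hdeg : ∀ i j, α * degMat G i j ≤ α * degMat H i j := by
    intro i j
    refine mul_le_mul_of_nonneg_left ?_ hα
    unfold degMat
    split_ifs
    · exact_mod_cast Set.ncard_le_ncard (fun x hx => hGH.le hx) (Set.toFinite _)
    · rfl
  have hadj : ∀ i j, adjMat G i j ≤ adjMat H i j := by
    intro i j
    unfold adjMat
    by_cases h : G.Adj i j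
    · simp [h, hGH.le h]
    · simp only [h, if_false]; split_ifs <;> simp
  obtain ⟨a, b, hab, hab'⟩ : ∃ a b, H.Adj a b ∧ ¬ G.Adj a b := by
    by_contra! h
    exact hGH.not_ge fun a b => h a b
  refine specRad_lt_specRad_of_connected (herm G) (herm H)
    (fun i j => add_nonneg (deg0 G i j) (adj0 G i j))
    (fun i j => add_le_add (hdeg i j) (hadj i j)) hH
    (fun i j h => add_pos_of_nonneg_of_pos (deg0 H i j) (by simp [adjMat, h])) (a := a) (b := b)
    (add_lt_add_of_le_of_lt (hdeg a b) (by simp [adjMat, hab, hab']))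

lemma SimpleGraph.Subgraph.IsMatching.two_mul_ncard_edgeSet {V : Type*} [Fintype V]
    {G : SimpleGraph V} {M : G.Subgraph} (hM : M.IsMatching) :
    2 * M.edgeSet.ncard = M.verts.ncard := by
  have h := M.spanningCoe.sum_degrees_eq_twice_card_edges
  have hd : ∀ v, M.spanningCoe.degree v = if v ∈ M.verts then 1 else 0 := by
    intro v
    split_ifs with hv
    · rw [SimpleGraph.degree_eq_one_iff_existsUnique_adj]
      simpa using hM hv
    · rw [SimpleGraph.degree_eq_zero_iff_notMem_support]
      rintro ⟨w, hw⟩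
      exact hv (M.edge_vert hw)
  simp only [hd] at h
  rw [Finset.sum_boole] at h
  have he : M.edgeSet = (M.spanningCoe.edgeFinset : Set (Sym2 V)) := by
    simp
  have hv : M.verts = ((Finset.univ.filter (· ∈ M.verts) : Finset V) : Set V) := by
    simp
  rw [he, Set.ncard_coe_finset, hv, Set.ncard_coe_finset, ← h]
  simp

lemma SimpleGraph.Subgraph.IsMatching.two_mul_ncard_edgeSet_add_card_le {V ι : Type*} [Fintype V]
    [Fintype ι] {H : SimpleGraph V} {M : H.Subgraph} (hM : M.IsMatching) (S : Set V) (l : V → ι)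
    (hodd : ∀ i, Odd {v | v ∉ S ∧ l v = i}.ncard)
    (hl : ∀ u v, H.Adj u v → u ∉ S → v ∉ S → l u = l v) :
    2 * M.edgeSet.ncard + Fintype.card ι ≤ Fintype.card V + S.ncard := by
  have key : ∀ i, ∃ x : ↥(M.vertsᶜ) ⊕ ↥S,
      (∃ v, x = Sum.inl v ∧ l v = i) ∨ ∃ w v, x = Sum.inr w ∧ M.Adj v w ∧ l v = i := by
    intro i
    by_contra! hcon
    have hmem : ∀ v, l v = i → v ∈ M.verts := fun v hv => by
      by_contra hv'
      exact (hcon (Sum.inl ⟨v, hv'⟩)).1 ⟨v, hv'⟩ rfl hv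
    have hmem' : ∀ v w, l v = i → M.Adj v w → w ∉ S := fun v w hv hvw hw =>
      (hcon (Sum.inr ⟨w, hw⟩)).2 ⟨w, hw⟩ v rfl hvw hv
    have hP : (M.induce {v | v ∉ S ∧ l v = i}).IsMatching := by
      rintro v ⟨hvS, hv⟩
      obtain ⟨w, hw, hw'⟩ := hM (hmem v hv)
      have hwS := hmem' v w hv hw
      refine ⟨w, ⟨⟨hvS, hv⟩, ⟨hwS, ?_⟩, hw⟩, fun y hy => hw' y hy.2.2⟩
      rw [← hl v w (M.adj_sub hw) hvS hwS, hv]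
    have := hP.two_mul_ncard_edgeSet
    exact Nat.not_even_iff_odd.2 (hodd i) ⟨_, by rw [← two_mul, this]; rfl⟩
  choose f hf using key
  have hinj : Function.Injective f := by
    intro i j hij
    rcases hf i with ⟨v, h1, rfl⟩ | ⟨w, v, h1, h2, rfl⟩ <;>
    rcases hf j with ⟨v', h1', rfl⟩ | ⟨w', v', h1', h2', rfl⟩
    · rw [h1, h1', Sum.inl.injEq] at hij
      rw [hij]
    · simp [h1, h1'] at hij
    · simp [h1, h1'] at hij
    · rw [h1, h1', Sum.inr.injEq] at hij
      rw [hM.eq_of_adj_right h2 (hij ▸ h2')]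
  have hcard := Nat.card_le_card_of_injective f hinj
  rw [Nat.card_sum, Nat.card_coe_set_eq, Nat.card_coe_set_eq, Nat.card_eq_fintype_card] at hcard
  have h2 := M.verts.ncard_add_ncard_compl
  rw [Nat.card_eq_fintype_card] at h2
  have h3 := hM.two_mul_ncard_edgeSet
  lia

lemma bddAbove_matching_sizes {V : Type*} [Fintype V] (G : SimpleGraph V) :
    BddAbove {m : ℕ | ∃ M : G.Subgraph, M.IsMatching ∧ M.edgeSet.ncard = m} := by
  refine ⟨Nat.card (Sym2 V), ?_⟩
  rintro m ⟨M, -, rfl⟩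
  exact Set.ncard_le_card _

lemma le_matchingNumber {V : Type*} [Fintype V] {G : SimpleGraph V} {M : G.Subgraph}
    (hM : M.IsMatching) : M.edgeSet.ncard ≤ matchingNumber G :=
  le_csSup (bddAbove_matching_sizes G) ⟨M, hM, rfl⟩

lemma exists_isMatching_ncard_eq {V : Type*} [Fintype V] (G : SimpleGraph V) :
    ∃ M : G.Subgraph, M.IsMatching ∧ M.edgeSet.ncard = matchingNumber G :=
  Nat.sSup_mem (s := {m : ℕ | ∃ M : G.Subgraph, M.IsMatching ∧ M.edgeSet.ncard = m})
    ⟨0, ⊥, by simp [SimpleGraph.Subgraph.IsMatching], by simp⟩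
    (bddAbove_matching_sizes G)

lemma matchingNumber_mono {V : Type*} [Fintype V] {G H : SimpleGraph V} (h : G ≤ H) :
    matchingNumber G ≤ matchingNumber H := by
  obtain ⟨M, hM, hMc⟩ := exists_isMatching_ncard_eq G
  have h1 := le_matchingNumber (hM.map_ofLE h)
  have h2 := hM.two_mul_ncard_edgeSet
  have h3 := (hM.map_ofLE h).two_mul_ncard_edgeSet
  have h4 : (M.map (SimpleGraph.Hom.ofLE h)).verts = M.verts := by simp
  rw [h4] at h3
  lia

lemma SimpleGraph.Iso.ncard_oddComponents_eq {V W : Type*} {G : SimpleGraph V}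
    {H : SimpleGraph W} (φ : G ≃g H) : G.oddComponents.ncard = H.oddComponents.ncard := by
  rw [← Nat.card_coe_set_eq, ← Nat.card_coe_set_eq]
  refine Nat.card_congr (φ.connectedComponentEquiv.subtypeEquiv fun c => ?_)
  have : c.supp.ncard = (φ.connectedComponentEquiv c).supp.ncard := by
    rw [← Nat.card_coe_set_eq, ← Nat.card_coe_set_eq]
    exact Nat.card_congr (SimpleGraph.ConnectedComponent.isoEquivSupp φ c)
  simp only [SimpleGraph.oddComponents, Set.mem_ofPred_eq, this]

lemma even_card_add_ncard_add_oddComponentsOutside {V : Type*} [Fintype V] (G : SimpleGraph V)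
    (S : Set V) : Even (Fintype.card V + S.ncard + oddComponentsOutside G S) := by
  have h : Odd (oddComponentsOutside G S) ↔ Odd Sᶜ.ncard := by
    rw [← Nat.card_coe_set_eq]
    exact SimpleGraph.odd_ncard_oddComponents (G.induce Sᶜ)
  have h2 := S.ncard_add_ncard_compl
  rw [Nat.card_eq_fintype_card] at h2
  rw [← h2]
  grind

lemma graphJoin_adj_inl_inl {A B : Type*} {G : SimpleGraph A} {H : SimpleGraph B} {a b : A} :
    (graphJoin G H).Adj (Sum.inl a) (Sum.inl b) ↔ G.Adj a b := by
  simp only [graphJoin, SimpleGraph.fromRel_adj, G.adj_comm b a, or_self, ne_eq, Sum.inl.injEq,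
    and_iff_right_iff_imp]
  exact SimpleGraph.Adj.ne

lemma graphJoin_adj_inr_inr {A B : Type*} {G : SimpleGraph A} {H : SimpleGraph B} {a b : B} :
    (graphJoin G H).Adj (Sum.inr a) (Sum.inr b) ↔ H.Adj a b := by
  simp only [graphJoin, SimpleGraph.fromRel_adj, H.adj_comm b a, or_self, ne_eq, Sum.inr.injEq,
    and_iff_right_iff_imp]
  exact SimpleGraph.Adj.ne

lemma graphJoin_adj_inl_inr {A B : Type*} {G : SimpleGraph A} {H : SimpleGraph B} {a : A} {b : B} :
    (graphJoin G H).Adj (Sum.inl a) (Sum.inr b) := by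
  simp [graphJoin, SimpleGraph.fromRel_adj]

lemma not_isTutteViolator_graphJoin_top {V : Type*} [Fintype V] {G : SimpleGraph V} {k : ℕ}
    (hk : ∀ T : Set V, oddComponentsOutside G T ≤ T.ncard + k) (heven : Even (Fintype.card V + k))
    (u : Set (V ⊕ Fin k)) :
    ¬ (graphJoin G (⊤ : SimpleGraph (Fin k))).IsTutteViolator u := by
  unfold SimpleGraph.IsTutteViolator
  set G' := graphJoin G (⊤ : SimpleGraph (Fin k))
  rw [not_lt]
  by_cases h : ∀ j, Sum.inr j ∈ u
  · let T : Set V := Sum.inl ⁻¹' u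
    have hu : u.ncard = T.ncard + k := by
      have : u = Sum.inl '' T ∪ Sum.inr '' (Set.univ : Set (Fin k)) := by
        ext (x | x) <;> simp [T, h]
      rw [this, Set.ncard_union_eq, Set.ncard_image_of_injective _ Sum.inl_injective,
        Set.ncard_image_of_injective _ Sum.inr_injective, Set.ncard_univ, Nat.card_fin]
      exact Set.isCompl_range_inl_range_inr.disjoint.mono (Set.image_subset_range _ _)
        (Set.image_subset_range _ _)
    let φ : G.induce Tᶜ ≃g ((⊤ : G'.Subgraph).deleteVerts u).coe :=
      { toEquiv := Equiv.ofBijective (fun x => ⟨Sum.inl x.1, Set.mem_univ _, x.2⟩) (by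
          constructor
          · intro x y hxy
            simpa [Subtype.ext_iff] using hxy
          · rintro ⟨x | x, hx⟩
            · exact ⟨⟨x, hx.2⟩, rfl⟩
            · simp [h] at hx)
        map_rel_iff' := by
          rintro ⟨x, hx⟩ ⟨y, hy⟩
          have hx' : Sum.inl x ∉ u := hx
          have hy' : Sum.inl y ∉ u := hy
          change ((⊤ : G'.Subgraph).deleteVerts u).Adj (Sum.inl x) (Sum.inl y) ↔ G.Adj x y
          simp [hx', hy', G', graphJoin_adj_inl_inl] }
    rw [← φ.ncard_oddComponents_eq, hu]
    exact hk T
  · push Not at h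
    obtain ⟨j, hj⟩ := h
    set K := ((⊤ : G'.Subgraph).deleteVerts u).coe with hK
    have hjK : Sum.inr j ∈ ((⊤ : G'.Subgraph).deleteVerts u).verts := by simpa using hj
    have hreach : ∀ x, K.Reachable x ⟨Sum.inr j, hjK⟩ := by
      rintro ⟨x, hx⟩
      by_cases hxj : x = Sum.inr j
      · subst hxj; rfl
      · refine SimpleGraph.Adj.reachable ?_
        have hx' : x ∉ u := by simpa using hx
        have : G'.Adj x (Sum.inr j) := by
          rcases x with x | x
          · exact graphJoin_adj_inl_inr
          · exact graphJoin_adj_inr_inr.2 (by simpa using hxj)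
        simpa [hK, hj, hx'] using this
    have hpre : K.Preconnected := fun x y => (hreach x).trans (hreach y).symm
    have hsub : Subsingleton K.ConnectedComponent := hpre.subsingleton_connectedComponent
    have hle : K.oddComponents.ncard ≤ 1 := Set.ncard_le_one_of_subsingleton _
    rcases Nat.eq_zero_or_pos u.ncard with hu | hu
    · have hu' : u = ∅ := (Set.ncard_eq_zero).1 hu
      have hnot : ¬ Odd K.oddComponents.ncard := by
        rw [SimpleGraph.odd_ncard_oddComponents, Nat.not_odd_iff_even, Nat.card_coe_set_eq]
        simpa [hu', Set.ncard_univ] using heven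
      have : K.oddComponents.ncard ≠ 1 := fun h => hnot (h ▸ odd_one)
      lia
    · exact hle.trans hu

lemma card_le_two_mul_matchingNumber_add {V : Type*} [Fintype V] {G : SimpleGraph V} {k : ℕ}
    (hk : ∀ T : Set V, oddComponentsOutside G T ≤ T.ncard + k)
    (heven : Even (Fintype.card V + k)) : Fintype.card V ≤ 2 * matchingNumber G + k := by
  obtain ⟨M, hM, hspan⟩ := SimpleGraph.tutte.2 (not_isTutteViolator_graphJoin_top hk heven)
  let N : G.Subgraph :=
    { verts := {v | ∃ w, M.Adj (Sum.inl v) (Sum.inl w)}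
      Adj := fun v w => M.Adj (Sum.inl v) (Sum.inl w)
      adj_sub := fun h => graphJoin_adj_inl_inl.1 (M.adj_sub h)
      edge_vert := fun h => ⟨_, h⟩
      symm := ⟨fun _ _ h => h.symm⟩ }
  have hN : N.IsMatching := by
    rintro v ⟨w, hw⟩
    exact ⟨w, hw, fun y hy => Sum.inl_injective (hM.eq_of_adj_left hy hw)⟩
  have hpartner : ∀ v : ↥(N.vertsᶜ), ∃ j : Fin k, M.Adj (Sum.inl v.1) (Sum.inr j) := by
    rintro ⟨v, hv⟩
    obtain ⟨w | w, hw, -⟩ := hM (hspan (Sum.inl v))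
    · exact absurd ⟨w, hw⟩ hv
    · exact ⟨w, hw⟩
  choose g hg using hpartner
  have hg_inj : Function.Injective g := fun v w h =>
    Subtype.ext (Sum.inl_injective (hM.eq_of_adj_right (hg v) (h ▸ hg w)))
  have h1 := Nat.card_le_card_of_injective g hg_inj
  rw [Nat.card_coe_set_eq, Nat.card_fin] at h1
  have h2 := N.verts.ncard_add_ncard_compl
  rw [Nat.card_eq_fintype_card] at h2
  have h3 := hN.two_mul_ncard_edgeSet
  have h4 := le_matchingNumber hN
  lia

/-- The join of the complete graph on `S` with the disjoint union of the complete graphs on the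
fibres of `l` outside `S`. -/
def joinOfFibers {V ι : Type*} (S : Set V) (l : V → ι) : SimpleGraph V where
  Adj u v := u ≠ v ∧ (u ∈ S ∨ v ∈ S ∨ l u = l v)
  symm := ⟨fun _ _ h => ⟨h.1.symm, by have := h.2; tauto⟩⟩
  loopless := ⟨fun _ h => h.1 rfl⟩

lemma connected_joinOfFibers {V ι : Type*} {S : Set V} (l : V → ι) (hS : S.Nonempty) :
    (joinOfFibers S l).Connected := by
  obtain ⟨a, ha⟩ := hS
  rw [SimpleGraph.connected_iff_exists_forall_reachable]
  refine ⟨a, fun v => ?_⟩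
  by_cases h : a = v
  · subst h; rfl
  · exact SimpleGraph.Adj.reachable ⟨h, Or.inl ha⟩

lemma nonempty_iso_of_eq_joinOfFibers {V : Type*} [Fintype V] {q s : ℕ} {G : SimpleGraph V}
    {S : Set V} {l : V → Fin q} (hG : G = joinOfFibers S l) (hS : S.ncard = s) :
    Nonempty (G ≃g graphJoin (⊤ : SimpleGraph (Fin s))
      (cliquesUnion q fun i => {v | v ∉ S ∧ l v = i}.ncard)) := by
  subst hG
  let eS : ↥S ≃ Fin s := Finite.equivFinOfCardEq (by rw [Nat.card_coe_set_eq, hS])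
  let eF : ∀ i, {x : ↥Sᶜ // l x = i} ≃ Fin ({v | v ∉ S ∧ l v = i}.ncard) := fun i =>
    (Equiv.subtypeSubtypeEquivSubtypeInter (· ∈ Sᶜ) (fun v => l v = i)).trans
      (Finite.equivFinOfCardEq (Nat.card_coe_set_eq {v | v ∉ S ∧ l v = i}))
  let eC : ↥Sᶜ ≃ Σ i, Fin ({v | v ∉ S ∧ l v = i}.ncard) :=
    (Equiv.sigmaFiberEquiv fun x : ↥Sᶜ => l x).symm.trans (Equiv.sigmaCongrRight eF)
  let e : ↥S ⊕ ↥Sᶜ ≃ V := Equiv.Set.sumCompl S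
  refine ⟨⟨e.symm.trans (Equiv.sumCongr eS eC), ?_⟩⟩
  intro a b
  obtain ⟨x, rfl⟩ := e.surjective a
  obtain ⟨y, rfl⟩ := e.surjective b
  rw [Equiv.trans_apply, Equiv.trans_apply, e.symm_apply_apply, e.symm_apply_apply]
  have hne : e x ≠ e y ↔ x ≠ y := e.injective.ne_iff
  have hadj : (joinOfFibers S l).Adj (e x) (e y) ↔
      x ≠ y ∧ (e x ∈ S ∨ e y ∈ S ∨ l (e x) = l (e y)) := by
    rw [← hne]; rfl
  rw [hadj]
  rcases x with x | x <;> rcases y with y | y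
  · have : e (Sum.inl x) ∈ S := x.2
    simp [graphJoin_adj_inl_inl, this]
  · have : e (Sum.inl x) ∈ S := x.2
    simp [graphJoin_adj_inl_inr, this]
  · have : e (Sum.inl y) ∈ S := y.2
    simp [graphJoin_adj_inl_inr.symm, this]
  · have hx : e (Sum.inr x) ∉ S := x.2
    have hy : e (Sum.inr y) ∉ S := y.2
    have hlx : l (e (Sum.inr x)) = (eC x).1 := rfl
    have hly : l (e (Sum.inr y)) = (eC y).1 := rfl
    rw [hlx, hly]
    simp [graphJoin_adj_inr_inr, cliquesUnion, SimpleGraph.fromRel_adj, hx, hy]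
    grind

/-- The component of `G - S` containing a vertex if this component is odd, and `c₀` otherwise. -/
noncomputable def oddComponentLabel {V : Type*} (G : SimpleGraph V) (S : Set V)
    (c₀ : (G.induce Sᶜ).oddComponents) (v : V) : (G.induce Sᶜ).oddComponents :=
  if h : ∃ hv : v ∈ Sᶜ,
      (G.induce Sᶜ).connectedComponentMk ⟨v, hv⟩ ∈ (G.induce Sᶜ).oddComponents then
    ⟨(G.induce Sᶜ).connectedComponentMk ⟨v, h.1⟩, h.2⟩
  else c₀

lemma le_joinOfFibers_oddComponentLabel {V : Type*} (G : SimpleGraph V) (S : Set V)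
    (c₀ : (G.induce Sᶜ).oddComponents) : G ≤ joinOfFibers S (oddComponentLabel G S c₀) := by
  intro u v huv
  refine ⟨huv.ne, ?_⟩
  by_cases hu : u ∈ S
  · exact Or.inl hu
  by_cases hv : v ∈ S
  · exact Or.inr (Or.inl hv)
  have h : (G.induce Sᶜ).connectedComponentMk ⟨u, hu⟩ =
      (G.induce Sᶜ).connectedComponentMk ⟨v, hv⟩ :=
    SimpleGraph.ConnectedComponent.sound (SimpleGraph.Adj.reachable (by simpa using huv))
  have hu' : u ∈ Sᶜ := hu
  have hv' : v ∈ Sᶜ := hv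
  simp only [oddComponentLabel, hu', hv', exists_true_left, h, or_true]

lemma odd_ncard_fiber_oddComponentLabel {V : Type*} [Fintype V] (G : SimpleGraph V) (S : Set V)
    (c₀ i : (G.induce Sᶜ).oddComponents) :
    Odd {v | v ∉ S ∧ oddComponentLabel G S c₀ v = i}.ncard := by
  set l := oddComponentLabel G S c₀ with hl
  let a : (G.induce Sᶜ).oddComponents → ℕ := fun j => {v | v ∉ S ∧ l v = j}.ncard
  have hne : ∀ j, j ≠ c₀ → Odd (a j) := by
    intro j hj
    have : {v | v ∉ S ∧ l v = j} = Subtype.val '' j.1.supp := by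
      ext v
      constructor
      · rintro ⟨hv, hlv⟩
        refine ⟨⟨v, hv⟩, ?_, rfl⟩
        rw [hl, oddComponentLabel] at hlv
        split_ifs at hlv with h
        · rw [← hlv]; rfl
        · exact absurd hlv.symm hj
      · rintro ⟨⟨v, hv⟩, hvj, rfl⟩
        have hvj' : (G.induce Sᶜ).connectedComponentMk ⟨v, hv⟩ = j.1 := hvj
        refine ⟨hv, ?_⟩
        rw [hl, oddComponentLabel, dif_pos ⟨hv, hvj' ▸ j.2⟩]
        exact Subtype.ext hvj'
    change Odd {v | v ∉ S ∧ l v = j}.ncard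
    rw [this, Set.ncard_image_of_injective _ Subtype.val_injective]
    exact j.2
  by_cases hi : i ≠ c₀
  · exact hne i hi
  rw [not_not] at hi
  by_contra hcon
  have hsum : ∑ j, a j = Nat.card ↥Sᶜ := by
    rw [← Nat.card_congr (Equiv.sigmaFiberEquiv fun x : ↥Sᶜ => l x), Nat.card_sigma]
    refine Finset.sum_congr rfl fun j _ => ?_
    exact ((Nat.card_congr (Equiv.subtypeSubtypeEquivSubtypeInter (· ∈ Sᶜ)
      (fun v => l v = j))).trans (Nat.card_coe_set_eq {v | v ∉ S ∧ l v = j})).symm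
  have h1 := (G.induce Sᶜ).odd_ncard_oddComponents
  rw [← hsum, Finset.odd_sum_iff_odd_card_odd, ← Nat.card_coe_set_eq,
    Nat.card_eq_fintype_card] at h1
  have h2 : (Finset.univ.filter fun j => Odd (a j)) = Finset.univ.erase c₀ := by
    ext j
    by_cases hj : j = c₀
    · subst hj; subst hi; simpa using hcon
    · simp [hj, hne j hj]
  rw [h2, Finset.card_erase_of_mem (Finset.mem_univ _), Finset.card_univ] at h1
  have h3 : 0 < Fintype.card (G.induce Sᶜ).oddComponents := Fintype.card_pos_iff.2 ⟨c₀⟩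
  grind

theorem stmt14 (α : ℝ) (hα : 0 ≤ α) (n β s q : ℕ) (hβ : 1 ≤ β) (hn : 2 * β ≤ n)
    (G : SimpleGraph (Fin n)) (hm : matchingNumber G = β)
    (hmax : ∀ H : SimpleGraph (Fin n),
      matchingNumber H = β → alphaRadius α H ≤ alphaRadius α G)
    (S : Set (Fin n)) (hS : S.ncard = s) (hs : 1 ≤ s)
    (hTB : ∀ T : Set (Fin n),
      (n : ℤ) - oddComponentsOutside G S + S.ncard ≤
        (n : ℤ) - oddComponentsOutside G T + T.ncard)
    (hq : q = n + s - 2 * β) :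
    ∃ f : Fin q → ℕ, (∀ i, 1 ≤ f i) ∧ (∑ i, f i = n - s) ∧
      Nonempty (G ≃g graphJoin (⊤ : SimpleGraph (Fin s)) (cliquesUnion q f)) := by
  set o := oddComponentsOutside G S with ho
  have hk : ∀ T : Set (Fin n), oddComponentsOutside G T ≤ T.ncard + (o - s) := by
    intro T
    have := hTB T
    lia
  have hso : s ≤ o := by
    have := hTB ∅
    rw [Set.ncard_empty] at this
    lia
  have hpar := even_card_add_ncard_add_oddComponentsOutside G S
  rw [Fintype.card_fin, hS, ← ho] at hpar
  have hle := card_le_two_mul_matchingNumber_add hk (by rw [Fintype.card_fin]; grind)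
  rw [Fintype.card_fin, hm] at hle
  have hcard : Fintype.card (G.induce Sᶜ).oddComponents = o := by
    rw [← Nat.card_eq_fintype_card]; rfl
  obtain ⟨c₀⟩ : Nonempty (G.induce Sᶜ).oddComponents := Fintype.card_pos_iff.1 (by lia)
  set l := oddComponentLabel G S c₀
  have hGH : G ≤ joinOfFibers S l := le_joinOfFibers_oddComponentLabel G S c₀
  have hodd : ∀ i, Odd {v | v ∉ S ∧ l v = i}.ncard := odd_ncard_fiber_oddComponentLabel G S c₀
  have hmono := matchingNumber_mono hGH
  rw [hm] at hmono
  obtain ⟨M, hM, hMc⟩ := exists_isMatching_ncard_eq (joinOfFibers S l)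
  have hup := hM.two_mul_ncard_edgeSet_add_card_le S l hodd fun u v huv hu hv => by
    simpa [hu, hv] using huv.2
  rw [hcard, hMc, Fintype.card_fin, hS] at hup
  have hGeq : G = joinOfFibers S l := by
    by_contra hne
    have hlt := alphaRadius_lt_of_lt_of_connected hα (hGH.lt_of_ne hne)
      (connected_joinOfFibers l ((Set.ncard_pos).1 (by lia)))
    exact (hmax _ (by lia)).not_gt hlt
  have hqo : q = o := by lia
  let e : (G.induce Sᶜ).oddComponents ≃ Fin q := Fintype.equivFinOfCardEq (hcard.trans hqo.symm)
  have hfib : ∀ i, {v | v ∉ S ∧ (e ∘ l) v = i} = {v | v ∉ S ∧ l v = e.symm i} := by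
    intro i
    ext v
    simp [Equiv.eq_symm_apply]
  have hjoin : joinOfFibers S l = joinOfFibers S (e ∘ l) := by
    ext u v
    simp [joinOfFibers]
  obtain ⟨φ⟩ := nonempty_iso_of_eq_joinOfFibers (hGeq.trans hjoin) hS
  refine ⟨fun i => {v | v ∉ S ∧ (e ∘ l) v = i}.ncard, fun i => ?_, ?_, ⟨φ⟩⟩
  · simp only [hfib]
    exact (hodd _).pos
  · have := Nat.card_congr φ.toEquiv
    rw [Nat.card_sum, Nat.card_sigma, Nat.card_fin, Nat.card_fin] at this
    simp only [Nat.card_fin] at this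
    lia
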